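/- arXiv:1507.01056 — 5 statements merged into one kernel-verified Lean document; each statement's English description precedes it below -/
import Mathlib

section
/- Let n ≥ 1, let ν > 2 and S > 0 be real numbers. Suppose that for every compactly supported C¹ function u : ℝⁿ → ℝ one has ∫_{ℝⁿ} ‖∇u(x)‖ dx ≥ S · (∫_{ℝⁿ} |u(x)|^{ν/(ν−1)} dx)^{(ν−1)/ν}. Then for every compactly supported C¹ function φ : ℝⁿ → ℝ one has (∫_{ℝⁿ} ‖∇φ(x)‖² dx)^{1/2} ≥ ((ν−2)/(2(ν−1))) · S · (∫_{ℝⁿ} |φ(x)|^{2ν/(ν−2)} dx)^{(ν−2)/(2ν)}. -/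
open MeasureTheory

/-- Derivation of the `L²` Sobolev inequality from the `L¹` Sobolev inequality. -/
theorem L2_sobolev_of_L1_sobolev (n : ℕ) (hn : 1 ≤ n) (ν S : ℝ) (hν : 2 < ν) (hS : 0 < S)
    (h : ∀ u : EuclideanSpace ℝ (Fin n) → ℝ, ContDiff ℝ 1 u → HasCompactSupport u →
      S * (∫ x, |u x| ^ (ν / (ν - 1))) ^ ((ν - 1) / ν) ≤ ∫ x, ‖fderiv ℝ u x‖) :
    ∀ φ : EuclideanSpace ℝ (Fin n) → ℝ, ContDiff ℝ 1 φ → HasCompactSupport φ →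
      (ν - 2) / (2 * (ν - 1)) * S * (∫ x, |φ x| ^ (2 * ν / (ν - 2))) ^ ((ν - 2) / (2 * ν)) ≤
        (∫ x, ‖fderiv ℝ φ x‖ ^ 2) ^ ((1 : ℝ) / 2) := by
  intro φ hφ hsupp
  have h0 : 0 < ν := by linarith
  have h1 : 0 < ν - 1 := by linarith
  have h2 : 0 < ν - 2 := by linarith
  set p : ℝ := 2 * (ν - 1) / (ν - 2) with hp
  have hp1 : 1 < p := by rw [hp, lt_div_iff₀ h2]; linarith
  have hp0 : 0 < p := by linarith
  have hpsub : p - 1 = ν / (ν - 2) := by rw [hp]; field_simp; ring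
  have hcomp {r : ℝ} (hr : 0 < r) : HasCompactSupport fun x ↦ |φ x| ^ r :=
    hsupp.comp_left (g := fun t : ℝ ↦ |t| ^ r) (by simp [hr.ne'])
  have hu := h (fun x ↦ ‖φ x‖ ^ p) (hφ.norm_rpow hp1) (hcomp hp0)
  have hA : ∀ x, |‖φ x‖ ^ p| ^ (ν / (ν - 1)) = |φ x| ^ (2 * ν / (ν - 2)) := fun x ↦ by
    rw [abs_of_nonneg (by positivity), Real.norm_eq_abs, ← Real.rpow_mul (abs_nonneg _)]
    congr 1
    rw [hp]
    field_simp
  have hgrad : ∀ x, ‖fderiv ℝ (fun x ↦ ‖φ x‖ ^ p) x‖ ≤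
      p * (|φ x| ^ (p - 1) * ‖fderiv ℝ φ x‖) := fun x ↦ by
    simpa [mul_assoc] using norm_fderiv_norm_rpow_le (x := x) (hφ.differentiable one_ne_zero) hp1
  have hcont : Continuous fun x ↦ |φ x| ^ (p - 1) :=
    hφ.continuous.abs.rpow_const fun x ↦ .inr (by linarith)
  have hcontG : Continuous fun x ↦ ‖fderiv ℝ φ x‖ := (hφ.continuous_fderiv one_ne_zero).norm
  have hsuppG : HasCompactSupport fun x ↦ ‖fderiv ℝ φ x‖ := (hsupp.fderiv ℝ).norm
  have hle : ∫ x, ‖fderiv ℝ (fun x ↦ ‖φ x‖ ^ p) x‖ ≤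
      p * ∫ x, |φ x| ^ (p - 1) * ‖fderiv ℝ φ x‖ := by
    rw [← integral_const_mul]
    exact integral_mono_of_nonneg (.of_forall fun x ↦ norm_nonneg _)
      (((hcont.mul hcontG).integrable_of_hasCompactSupport hsuppG.mul_left).const_mul p)
      (.of_forall hgrad)
  have hCS := integral_mul_le_Lp_mul_Lq_of_nonneg (μ := volume) Real.HolderConjugate.two_two
    (f := fun x ↦ |φ x| ^ (p - 1)) (g := fun x ↦ ‖fderiv ℝ φ x‖)
    (.of_forall fun x ↦ by positivity) (.of_forall fun x ↦ norm_nonneg _)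
    (hcont.memLp_of_hasCompactSupport (hcomp (by linarith)))
    (hcontG.memLp_of_hasCompactSupport hsuppG)
  have hB : ∀ x, (|φ x| ^ (p - 1)) ^ (2 : ℝ) = |φ x| ^ (2 * ν / (ν - 2)) := fun x ↦ by
    rw [← Real.rpow_mul (abs_nonneg _), hpsub]
    congr 1
    ring
  simp only [hB, Real.rpow_two] at hCS
  simp only [hA] at hu
  set A := ∫ x, |φ x| ^ (2 * ν / (ν - 2))
  set G := (∫ x, ‖fderiv ℝ φ x‖ ^ 2) ^ ((1 : ℝ) / 2)
  have hG0 : 0 ≤ G := by positivity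
  have hA0 : 0 ≤ A := by positivity
  rcases hA0.eq_or_lt with hA0 | hA0
  · rw [← hA0, Real.zero_rpow (by positivity), mul_zero]
    exact hG0
  have hexp : A ^ ((ν - 1) / ν) = A ^ ((ν - 2) / (2 * ν)) * A ^ ((1 : ℝ) / 2) := by
    rw [← Real.rpow_add hA0]
    congr 1
    field_simp
    ring
  have hmain : S * A ^ ((ν - 2) / (2 * ν)) ≤ p * G := by
    refine le_of_mul_le_mul_right ?_ (Real.rpow_pos_of_pos hA0 ((1 : ℝ) / 2))
    calc S * A ^ ((ν - 2) / (2 * ν)) * A ^ ((1 : ℝ) / 2)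
        = S * A ^ ((ν - 1) / ν) := by rw [hexp, mul_assoc]
      _ ≤ p * (A ^ ((1 : ℝ) / 2) * G) := hu.trans (hle.trans (by gcongr))
      _ = p * G * A ^ ((1 : ℝ) / 2) := by ring
  have hpinv : (ν - 2) / (2 * (ν - 1)) = p⁻¹ := by rw [hp, inv_div]
  rw [hpinv, mul_assoc, inv_mul_le_iff₀ hp0]
  exact hmain
end

section
/- Let n ≥ 1, let ν > 2 and S > 0 be real numbers. Suppose that for every compactly supported C¹ function u : ℝⁿ → ℝ one has ∫_{ℝⁿ} ‖∇u(x)‖ dx ≥ S · (∫_{ℝⁿ} |u(x)|^{ν/(ν−1)} dx)^{(ν−1)/ν}. Then Nash's inequality holds: for every compactly supported C¹ function φ : ℝⁿ → ℝ, (∫_{ℝⁿ} φ(x)² dx)^{(ν+2)/ν} ≤ ((ν−2)/(2(ν−1)) · S)^{−2} · (∫_{ℝⁿ} ‖∇φ(x)‖² dx) · (∫_{ℝⁿ} |φ(x)| dx)^{4/ν}. -/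
open MeasureTheory

section CompactSupport

variable {X : Type*} [TopologicalSpace X] {f : X → ℝ}

lemma HasCompactSupport.abs_rpow (hf : HasCompactSupport f) {r : ℝ} (hr : r ≠ 0) :
    HasCompactSupport fun x ↦ |f x| ^ r :=
  hf.comp_left (g := fun t : ℝ ↦ |t| ^ r) (by simp [Real.zero_rpow hr])

lemma Continuous.abs_rpow_const (hf : Continuous f) {r : ℝ} (hr : 0 ≤ r) :
    Continuous fun x ↦ |f x| ^ r :=
  hf.abs.rpow_const fun _ ↦ Or.inr hr

variable [MeasurableSpace X] [OpensMeasurableSpace X] (μ : Measure X)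
  [IsFiniteMeasureOnCompacts μ]

/-- Log-convexity of `r ↦ ∫ |f| ^ r` between the exponents `p` and `1`, evaluated at `2`. -/
lemma integral_sq_le_rpow_mul_rpow (hf : Continuous f) (hfc : HasCompactSupport f)
    {a b p : ℝ} (ha : 0 < a) (hb : 0 < b) (hp : 0 < p) (hab : a + b = 1) (hpab : p * a + b = 2) :
    ∫ x, f x ^ 2 ∂μ ≤ (∫ x, |f x| ^ p ∂μ) ^ a * (∫ x, |f x| ∂μ) ^ b := by
  have hconj : (1 / a).HolderConjugate (1 / b) := by
    rw [Real.holderConjugate_iff]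
    refine ⟨by rw [lt_div_iff₀ ha]; linarith, by simpa using hab⟩
  have holder := integral_mul_le_Lp_mul_Lq_of_nonneg (μ := μ) hconj
    (f := fun x ↦ |f x| ^ (p * a)) (g := fun x ↦ |f x| ^ b)
    (.of_forall fun x ↦ by positivity) (.of_forall fun x ↦ by positivity)
    ((hf.abs_rpow_const (by positivity)).memLp_of_hasCompactSupport
      (hfc.abs_rpow (by positivity)))
    ((hf.abs_rpow_const hb.le).memLp_of_hasCompactSupport (hfc.abs_rpow hb.ne'))
  have hleft (x : X) : |f x| ^ (p * a) * |f x| ^ b = f x ^ 2 := by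
    rw [← Real.rpow_add' (abs_nonneg _) (by rw [hpab]; norm_num), hpab, Real.rpow_two, sq_abs]
  have hfst (x : X) : (|f x| ^ (p * a)) ^ (1 / a) = |f x| ^ p := by
    rw [← Real.rpow_mul (abs_nonneg _)]
    congr 1
    field_simp
  have hsnd (x : X) : (|f x| ^ b) ^ (1 / b) = |f x| := by
    rw [← Real.rpow_mul (abs_nonneg _), mul_one_div_cancel hb.ne', Real.rpow_one]
  simpa only [hleft, hfst, hsnd, one_div_one_div] using holder

end CompactSupport

section Gradient

variable {E : Type*} [NormedAddCommGroup E] [NormedSpace ℝ E] [MeasurableSpace E] [BorelSpace E]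
  (μ : Measure E) [IsFiniteMeasureOnCompacts μ] {f : E → ℝ}

lemma integral_norm_fderiv_abs_rpow_le (hf : ContDiff ℝ 1 f) (hfc : HasCompactSupport f)
    {γ : ℝ} (hγ : 1 < γ) :
    ∫ x, ‖fderiv ℝ (fun y ↦ |f y| ^ γ) x‖ ∂μ ≤
      γ * ((∫ x, |f x| ^ (2 * (γ - 1)) ∂μ) ^ (1 / 2 : ℝ) *
        (∫ x, ‖fderiv ℝ f x‖ ^ 2 ∂μ) ^ (1 / 2 : ℝ)) := by
  have hγ' : 0 < γ - 1 := sub_pos.2 hγ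
  have hpow : Continuous fun x ↦ |f x| ^ (γ - 1) := hf.continuous.abs_rpow_const hγ'.le
  have hpowc : HasCompactSupport fun x ↦ |f x| ^ (γ - 1) := hfc.abs_rpow hγ'.ne'
  have hgrad : Continuous fun x ↦ ‖fderiv ℝ f x‖ := (hf.continuous_fderiv one_ne_zero).norm
  have hgradc : HasCompactSupport fun x ↦ ‖fderiv ℝ f x‖ := (hfc.fderiv (𝕜 := ℝ)).norm
  have hu : ContDiff ℝ 1 fun y ↦ |f y| ^ γ := hf.norm_rpow hγ
  have huc : HasCompactSupport fun y ↦ |f y| ^ γ := hfc.abs_rpow (by linarith)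
  have holder := integral_mul_le_Lp_mul_Lq_of_nonneg (μ := μ) Real.HolderConjugate.two_two
    (f := fun x ↦ |f x| ^ (γ - 1)) (g := fun x ↦ ‖fderiv ℝ f x‖)
    (.of_forall fun x ↦ by positivity) (.of_forall fun x ↦ by positivity)
    (hpow.memLp_of_hasCompactSupport hpowc) (hgrad.memLp_of_hasCompactSupport hgradc)
  have hsq (x : E) : (|f x| ^ (γ - 1)) ^ (2 : ℝ) = |f x| ^ (2 * (γ - 1)) := by
    rw [← Real.rpow_mul (abs_nonneg _), mul_comm]
  simp only [hsq, Real.rpow_two] at holder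
  calc ∫ x, ‖fderiv ℝ (fun y ↦ |f y| ^ γ) x‖ ∂μ
      ≤ ∫ x, γ * (|f x| ^ (γ - 1) * ‖fderiv ℝ f x‖) ∂μ := by
        refine integral_mono
          ((hu.continuous_fderiv one_ne_zero).norm.integrable_of_hasCompactSupport
            (huc.fderiv (𝕜 := ℝ)).norm)
          (((hpow.mul hgrad).integrable_of_hasCompactSupport hpowc.mul_right).const_mul γ)
          fun x ↦ ?_
        rw [← mul_assoc]
        exact norm_fderiv_norm_rpow_le (hf.differentiable one_ne_zero) hγ
    _ = γ * ∫ x, |f x| ^ (γ - 1) * ‖fderiv ℝ f x‖ ∂μ := integral_const_mul _ _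
    _ ≤ _ := by gcongr

end Gradient

lemma rpow_le_of_mul_rpow_le_mul_sqrt {A D S γ θ : ℝ} (hA : 0 ≤ A) (hD : 0 ≤ D) (hS : 0 < S)
    (hγ : 0 < γ) (hθ : 0 < θ)
    (h : S * A ^ ((1 + θ) / 2) ≤ γ * (A ^ (1 / 2 : ℝ) * D ^ (1 / 2 : ℝ))) :
    A ^ θ ≤ (1 / γ * S) ^ (-(2 : ℝ)) * D := by
  obtain rfl | hA := hA.eq_or_lt
  · rw [Real.zero_rpow hθ.ne']
    positivity
  have hsplit : A ^ ((1 + θ) / 2) = A ^ (1 / 2 : ℝ) * A ^ (θ / 2) := by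
    rw [← Real.rpow_add hA]
    ring_nf
  have hroot : S * A ^ (θ / 2) ≤ γ * D ^ (1 / 2 : ℝ) := by
    refine le_of_mul_le_mul_left ?_ (Real.rpow_pos_of_pos hA (1 / 2))
    rw [hsplit] at h
    linarith
  have hsq := pow_le_pow_left₀ (by positivity) hroot 2
  rw [mul_pow, mul_pow, ← Real.rpow_mul_natCast hA.le, ← Real.rpow_mul_natCast hD] at hsq
  norm_num at hsq
  rw [Real.rpow_neg (by positivity), Real.rpow_two, inv_mul_eq_div, le_div_iff₀ (by positivity)]
  field_simp
  linarith

/-- Nash's inequality derived from the `L¹` Sobolev inequality. -/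
theorem nash_inequality_of_L1_sobolev (n : ℕ) (hn : 1 ≤ n) (ν S : ℝ) (hν : 2 < ν) (hS : 0 < S)
    (h : ∀ u : EuclideanSpace ℝ (Fin n) → ℝ, ContDiff ℝ 1 u → HasCompactSupport u →
      S * (∫ x, |u x| ^ (ν / (ν - 1))) ^ ((ν - 1) / ν) ≤ ∫ x, ‖fderiv ℝ u x‖) :
    ∀ φ : EuclideanSpace ℝ (Fin n) → ℝ, ContDiff ℝ 1 φ → HasCompactSupport φ →
      (∫ x, φ x ^ 2) ^ ((ν + 2) / ν) ≤
        ((ν - 2) / (2 * (ν - 1)) * S) ^ (-(2 : ℝ)) * (∫ x, ‖fderiv ℝ φ x‖ ^ 2) *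
          (∫ x, |φ x|) ^ (4 / ν) := by
  intro φ hφ hφc
  have hν0 : 0 < ν := by linarith
  have hν1 : 0 < ν - 1 := by linarith
  have hν2 : 0 < ν - 2 := by linarith
  set γ : ℝ := 2 * (ν - 1) / (ν - 2) with hγ
  set p : ℝ := 2 * ν / (ν - 2) with hp
  have hγ1 : 1 < γ := by rw [hγ, lt_div_iff₀ hν2]; linarith
  have hpγ : 2 * (γ - 1) = p := by rw [hγ, hp]; field_simp; ring
  have hp0 : 0 < p := by positivity
  have hA : 0 ≤ ∫ x, |φ x| ^ p := integral_nonneg fun x ↦ by positivity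
  have hD : 0 ≤ ∫ x, ‖fderiv ℝ φ x‖ ^ 2 := integral_nonneg fun x ↦ by positivity
  have hL : 0 ≤ ∫ x, |φ x| := integral_nonneg fun x ↦ by positivity
  have hu (x) : |(|φ x| ^ γ)| ^ (ν / (ν - 1)) = |φ x| ^ p := by
    rw [abs_of_nonneg (by positivity), ← Real.rpow_mul (abs_nonneg _)]
    congr 1
    rw [hγ, hp]
    field_simp
  have hsob := (h _ (hφ.norm_rpow hγ1) (hφc.abs_rpow (by linarith))).trans
    (integral_norm_fderiv_abs_rpow_le volume hφ hφc hγ1)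
  simp only [Real.norm_eq_abs, hu, hpγ] at hsob
  have hexp : (ν - 1) / ν = (1 + (ν - 2) / ν) / 2 := by field_simp; ring
  rw [hexp] at hsob
  have hgrad := rpow_le_of_mul_rpow_le_mul_sqrt hA hD hS (zero_lt_one.trans hγ1)
    (by positivity) hsob
  rw [hγ, one_div_div] at hgrad
  have hinterp := integral_sq_le_rpow_mul_rpow volume hφ.continuous hφc
    (a := (ν - 2) / (ν + 2)) (b := 4 / (ν + 2)) (p := p) (by positivity) (by positivity) hp0
    (by field_simp; ring) (by rw [hp]; field_simp; ring)
  calc (∫ x, φ x ^ 2) ^ ((ν + 2) / ν)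
      ≤ ((∫ x, |φ x| ^ p) ^ ((ν - 2) / (ν + 2)) * (∫ x, |φ x|) ^ (4 / (ν + 2))) ^
          ((ν + 2) / ν) :=
        Real.rpow_le_rpow (integral_nonneg fun x ↦ by positivity) hinterp (by positivity)
    _ = (∫ x, |φ x| ^ p) ^ ((ν - 2) / ν) * (∫ x, |φ x|) ^ (4 / ν) := by
        rw [Real.mul_rpow (by positivity) (by positivity), ← Real.rpow_mul hA,
          ← Real.rpow_mul hL]
        congr 2 <;> field_simp
    _ ≤ _ := by gcongr
end

section
/- Let f : ℂ → ℂ be a smooth (C^∞) function with compact support. Then ∫_ℂ (|f_x(z)|² + |f_y(z)|²) dA(z) = 4 ∫_ℂ |∂f(z)|² dA(z). -/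
open MeasureTheory

/-- Two directional derivatives may be exchanged under the integral of a bilinear pairing of a
`C²` function with a compactly supported `C¹` function. -/
lemma integral_bilinear_fderiv_fderiv_comm {E F G W : Type*}
    [NormedAddCommGroup E] [NormedSpace ℝ E] [FiniteDimensional ℝ E]
    [MeasurableSpace E] [BorelSpace E]
    [NormedAddCommGroup F] [NormedSpace ℝ F] [NormedAddCommGroup G] [NormedSpace ℝ G]
    [NormedAddCommGroup W] [NormedSpace ℝ W] (μ : Measure E) [μ.IsAddHaarMeasure]
    (B : F →L[ℝ] G →L[ℝ] W) {f : E → F} {g : E → G}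
    (hf : ContDiff ℝ 2 f) (hg : ContDiff ℝ 1 g) (hsupp : HasCompactSupport g) (v w : E) :
    ∫ x, B (fderiv ℝ f x v) (fderiv ℝ g x w) ∂μ =
      ∫ x, B (fderiv ℝ f x w) (fderiv ℝ g x v) ∂μ := by
  have hf' : ContDiff ℝ 1 (fderiv ℝ f) := hf.fderiv_right (by norm_num)
  have hfv (u : E) : ContDiff ℝ 1 (fun x ↦ fderiv ℝ f x u) := hf'.clm_apply contDiff_const
  have hfu' (u u' : E) : Continuous (fun x ↦ fderiv ℝ (fun y ↦ fderiv ℝ f y u) x u') :=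
    ((hfv u).continuous_fderiv one_ne_zero).clm_apply continuous_const
  have hgu (u : E) : Continuous (fun x ↦ fderiv ℝ g x u) :=
    (hg.continuous_fderiv one_ne_zero).clm_apply continuous_const
  have integrable_pairing {a : E → F} {b : E → G} (ha : Continuous a) (hb : Continuous b)
      (hbs : HasCompactSupport b) : Integrable (fun x ↦ B (a x) (b x)) μ := by
    refine Continuous.integrable_of_hasCompactSupport (by fun_prop) ?_
    exact hbs.mono fun x hx hb0 ↦ hx (by simp [hb0])
  have parts (u u' : E) : ∫ x, B (fderiv ℝ f x u) (fderiv ℝ g x u') ∂μ =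
      -∫ x, B (fderiv ℝ (fun y ↦ fderiv ℝ f y u) x u') (g x) ∂μ :=
    integral_bilinear_fderiv_right_eq_neg_left_of_integrable
      (integrable_pairing (hfu' u u') hg.continuous hsupp)
      (integrable_pairing (hfv u).continuous (hgu u') (hsupp.fderiv_apply ℝ u'))
      (integrable_pairing (hfv u).continuous hg.continuous hsupp)
      (fun x _ ↦ (hfv u).differentiable one_ne_zero x)
      (fun x _ ↦ hg.differentiable one_ne_zero x)
  have second (x u u' : E) : fderiv ℝ (fun y ↦ fderiv ℝ f y u) x u' =
      fderiv ℝ (fderiv ℝ f) x u' u := by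
    rw [fderiv_clm_apply (hf'.differentiable one_ne_zero x) (differentiableAt_const u)]
    simp
  rw [parts v w, parts w v]
  congr 2 with x
  rw [second, second, (hf.contDiffAt.isSymmSndFDerivAt (by simp)) v w]

/-- For a smooth compactly supported `f : ℂ → ℂ`, `∫ (|f_x|² + |f_y|²) = 4 ∫ |∂f|²`, where
`∂f = (f_x − i f_y)/2` with `f_x, f_y` the partial derivatives of `f` in the directions
`1` and `i`. -/
theorem integral_grad_sq_eq_four_integral_d_sq (f : ℂ → ℂ)
    (hf : ContDiff ℝ (⊤ : ℕ∞) f) (hsupp : HasCompactSupport f) :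
    ∫ z : ℂ, (‖fderiv ℝ f z 1‖ ^ 2 + ‖fderiv ℝ f z Complex.I‖ ^ 2) =
      4 * ∫ z : ℂ, ‖(fderiv ℝ f z 1 - Complex.I * fderiv ℝ f z Complex.I) / 2‖ ^ 2 := by
  let B : ℂ →L[ℝ] ℂ →L[ℝ] ℝ := (innerSL ℝ).comp (ContinuousLinearMap.mul ℝ ℂ Complex.I)
  have hB (a b : ℂ) : B a b = a.re * b.im - a.im * b.re := by
    simp [B, Complex.inner]
    ring
  have hcont (u : ℂ) : Continuous (fun z ↦ fderiv ℝ f z u) :=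
    (hf.continuous_fderiv (by simp)).clm_apply continuous_const
  have hsq (u : ℂ) : Integrable (fun z ↦ ‖fderiv ℝ f z u‖ ^ 2) := by
    refine Continuous.integrable_of_hasCompactSupport ((hcont u).norm.pow 2) ?_
    exact (hsupp.fderiv_apply ℝ u).mono fun z hz h0 ↦ hz (by simp [h0])
  have hBint : Integrable (fun z ↦ B (fderiv ℝ f z 1) (fderiv ℝ f z Complex.I)) := by
    have h1 := hcont 1
    have hI := hcont Complex.I
    refine Continuous.integrable_of_hasCompactSupport (by fun_prop) ?_
    exact (hsupp.fderiv_apply ℝ Complex.I).mono fun z hz h0 ↦ hz (by simp [h0])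
  have hzero : ∫ z, B (fderiv ℝ f z 1) (fderiv ℝ f z Complex.I) = 0 := by
    have hswap := integral_bilinear_fderiv_fderiv_comm volume B
      (contDiff_infty.mp hf 2) (contDiff_infty.mp hf 1) hsupp 1 Complex.I
    have hanti (a b : ℂ) : B b a = -B a b := by
      rw [hB, hB]
      ring
    simp_rw [hanti (fderiv ℝ f _ 1) (fderiv ℝ f _ Complex.I), integral_neg] at hswap
    linarith
  have hpoint (a b : ℂ) : 4 * ‖(a - Complex.I * b) / 2‖ ^ 2 =
      ‖a‖ ^ 2 + ‖b‖ ^ 2 + 2 * B a b := by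
    rw [hB, norm_div, div_pow]
    simp only [Complex.sq_norm, Complex.normSq_apply]
    simp
    ring
  rw [← integral_const_mul]
  simp_rw [hpoint]
  have hgrad : Integrable (fun z ↦ ‖fderiv ℝ f z 1‖ ^ 2 + ‖fderiv ℝ f z Complex.I‖ ^ 2) :=
    (hsq 1).add (hsq Complex.I)
  rw [integral_add hgrad (hBint.const_mul 2), integral_const_mul, hzero]
  simp
end

section
/- Let U ⊆ ℝ² be open, let E, F, G : U → ℝ be C¹ functions with E > 0 and EG − F² > 0 on U, and set W = √(EG − F²), a₁₁ = G/W, a₁₂ = F/W, a₂₂ = E/W, b₁ = ∂a₁₁/∂x − ∂a₁₂/∂y, b₂ = ∂a₂₂/∂y − ∂a₁₂/∂x. Let u, v : U → ℝ be C² functions satisfying v_x = −a₁₂·u_x + a₂₂·u_y and v_y = −a₁₁·u_x + a₁₂·u_y on U. Then u satisfies the second-order equation a₁₁·u_xx − 2·a₁₂·u_xy + a₂₂·u_yy + b₁·u_x + b₂·u_y = 0 on U. -/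
/-- Partial derivative in the `x`-direction of a function on `ℝ²`. -/
noncomputable def pdx (f : ℝ × ℝ → ℝ) (p : ℝ × ℝ) : ℝ := fderiv ℝ f p (1, 0)

/-- Partial derivative in the `y`-direction of a function on `ℝ²`. -/
noncomputable def pdy (f : ℝ × ℝ → ℝ) (p : ℝ × ℝ) : ℝ := fderiv ℝ f p (0, 1)

theorem ContDiffAt.differentiableAt_fderiv_apply {f : ℝ × ℝ → ℝ} {p : ℝ × ℝ}
    (hf : ContDiffAt ℝ 2 f p) (w : ℝ × ℝ) :
    DifferentiableAt ℝ (fun q => fderiv ℝ f q w) p :=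
  ((hf.fderiv_right (m := 1) (by norm_num)).differentiableAt (by norm_num)).clm_apply
    (differentiableAt_const w)

theorem fderiv_fderiv_apply {f : ℝ × ℝ → ℝ} {p : ℝ × ℝ} (hf : ContDiffAt ℝ 2 f p)
    (w z : ℝ × ℝ) :
    fderiv ℝ (fun q => fderiv ℝ f q w) p z = fderiv ℝ (fderiv ℝ f) p z w := by
  have h : DifferentiableAt ℝ (fderiv ℝ f) p :=
    (hf.fderiv_right (m := 1) (by norm_num)).differentiableAt (by norm_num)
  rw [fderiv_clm_apply h (differentiableAt_const w)]
  simp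

/-- Equality of mixed partial derivatives. -/
theorem pdy_pdx_eq_pdx_pdy {f : ℝ × ℝ → ℝ} {p : ℝ × ℝ} (hf : ContDiffAt ℝ 2 f p) :
    pdy (pdx f) p = pdx (pdy f) p := by
  change fderiv ℝ (fun q => fderiv ℝ f q (1, 0)) p (0, 1) =
    fderiv ℝ (fun q => fderiv ℝ f q (0, 1)) p (1, 0)
  rw [fderiv_fderiv_apply hf, fderiv_fderiv_apply hf]
  exact (hf.isSymmSndFDerivAt (by simp)).eq _ _

/-- The Leibniz rule for a combination `-a * f + b * g`. -/
theorem fderiv_neg_mul_add_mul_apply {a b f g : ℝ × ℝ → ℝ} {p : ℝ × ℝ}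
    (ha : DifferentiableAt ℝ a p) (hb : DifferentiableAt ℝ b p)
    (hf : DifferentiableAt ℝ f p) (hg : DifferentiableAt ℝ g p) (w : ℝ × ℝ) :
    fderiv ℝ (fun q => -a q * f q + b q * g q) p w =
      -(fderiv ℝ a p w * f p + a p * fderiv ℝ f p w) +
        (fderiv ℝ b p w * g p + b p * fderiv ℝ g p w) := by
  have h := ((ha.hasFDerivAt.fun_neg.fun_mul hf.hasFDerivAt).fun_add
    (hb.hasFDerivAt.fun_mul hg.hasFDerivAt)).fderiv
  rw [h]
  simp
  ring

/-- Via `v_xy = v_yx`, a solution of the first-order system satisfies the second-order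
elliptic equation `a₁₁ u_xx − 2a₁₂ u_xy + a₂₂ u_yy + b₁ u_x + b₂ u_y = 0`, where
`a₁₁ = G/W`, `a₁₂ = F/W`, `a₂₂ = E/W`, `W = √(EG−F²)`,
`b₁ = ∂a₁₁/∂x − ∂a₁₂/∂y` and `b₂ = ∂a₂₂/∂y − ∂a₁₂/∂x`. -/
theorem second_order_equation_from_system (U : Set (ℝ × ℝ)) (hU : IsOpen U)
    (E F G u v : ℝ × ℝ → ℝ)
    (hE : ∀ p ∈ U, 0 < E p) (hEG : ∀ p ∈ U, 0 < E p * G p - F p ^ 2)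
    (hEc : ContDiffOn ℝ 1 E U) (hFc : ContDiffOn ℝ 1 F U) (hGc : ContDiffOn ℝ 1 G U)
    (hu : ContDiffOn ℝ 2 u U) (hv : ContDiffOn ℝ 2 v U)
    (hvx : ∀ p ∈ U,
      pdx v p = -(F p / Real.sqrt (E p * G p - F p ^ 2)) * pdx u p +
        (E p / Real.sqrt (E p * G p - F p ^ 2)) * pdy u p)
    (hvy : ∀ p ∈ U,
      pdy v p = -(G p / Real.sqrt (E p * G p - F p ^ 2)) * pdx u p +
        (F p / Real.sqrt (E p * G p - F p ^ 2)) * pdy u p) :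
    ∀ p ∈ U,
      (G p / Real.sqrt (E p * G p - F p ^ 2)) * pdx (pdx u) p -
        2 * (F p / Real.sqrt (E p * G p - F p ^ 2)) * pdx (pdy u) p +
        (E p / Real.sqrt (E p * G p - F p ^ 2)) * pdy (pdy u) p +
        (pdx (fun q => G q / Real.sqrt (E q * G q - F q ^ 2)) p -
          pdy (fun q => F q / Real.sqrt (E q * G q - F q ^ 2)) p) * pdx u p +
        (pdy (fun q => E q / Real.sqrt (E q * G q - F q ^ 2)) p -
          pdx (fun q => F q / Real.sqrt (E q * G q - F q ^ 2)) p) * pdy u p = 0 := by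
  intro p hp
  have hpU : U ∈ nhds p := hU.mem_nhds hp
  have hdE := (hEc.contDiffAt hpU).differentiableAt one_ne_zero
  have hdF := (hFc.contDiffAt hpU).differentiableAt one_ne_zero
  have hdG := (hGc.contDiffAt hpU).differentiableAt one_ne_zero
  have hup := hu.contDiffAt hpU
  have hW : DifferentiableAt ℝ (fun q => Real.sqrt (E q * G q - F q ^ 2)) p :=
    ((hdE.fun_mul hdG).fun_sub (hdF.fun_pow 2)).sqrt (hEG p hp).ne'
  have hW0 : (fun q => Real.sqrt (E q * G q - F q ^ 2)) p ≠ 0 := (Real.sqrt_pos.2 (hEG p hp)).ne'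
  have hdiv : ∀ {N : ℝ × ℝ → ℝ}, DifferentiableAt ℝ N p →
      DifferentiableAt ℝ (fun q => N q / Real.sqrt (E q * G q - F q ^ 2)) p :=
    fun hN => by
      simpa only [div_eq_mul_inv] using hN.fun_mul (hW.fun_inv hW0)
  have hux : DifferentiableAt ℝ (pdx u) p := hup.differentiableAt_fderiv_apply (1, 0)
  have huy : DifferentiableAt ℝ (pdy u) p := hup.differentiableAt_fderiv_apply (0, 1)
  have hvxy : pdy (pdx v) p = _ :=
    (congrArg (fun L : ℝ × ℝ →L[ℝ] ℝ => L (0, 1))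
      (Filter.EventuallyEq.fderiv_eq (Filter.eventuallyEq_of_mem hpU hvx))).trans
      (fderiv_neg_mul_add_mul_apply (hdiv hdF) (hdiv hdE) hux huy (0, 1))
  have hvyx : pdx (pdy v) p = _ :=
    (congrArg (fun L : ℝ × ℝ →L[ℝ] ℝ => L (1, 0))
      (Filter.EventuallyEq.fderiv_eq (Filter.eventuallyEq_of_mem hpU hvy))).trans
      (fderiv_neg_mul_add_mul_apply (hdiv hdG) (hdiv hdF) hux huy (1, 0))
  have hmixed := pdy_pdx_eq_pdx_pdy (hv.contDiffAt hpU)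
  have humixed := pdy_pdx_eq_pdx_pdy hup
  rw [hvxy, hvyx] at hmixed
  simp only [← pdx.eq_def, ← pdy.eq_def] at hmixed
  rw [humixed] at hmixed
  linear_combination hmixed
end

section
/- Let V ⊆ ℝ² be an open neighborhood of 0, let a₁₁, a₁₂, a₂₂, b₁, b₂ : V → ℝ be C² functions with a₁₁(0) = a₂₂(0) = 1 and a₁₂(0) = 0, and define the operator L by L u = a₁₁·u_xx − 2·a₁₂·u_xy + a₂₂·u_yy + b₁·u_x + b₂·u_y. Then there exists a polynomial function ζ : ℝ² → ℝ of degree at most 4 such that ∂ζ/∂x(0) = ∂ζ/∂y(0) = 1, Lζ(0) = 0, both first-order partial derivatives of Lζ vanish at 0, and all three second-order partial derivatives of Lζ vanish at 0. -/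
/-- The second-order elliptic operator
`L u = a₁₁ u_xx − 2a₁₂ u_xy + a₂₂ u_yy + b₁ u_x + b₂ u_y`. -/
noncomputable def ellOp (a₁₁ a₁₂ a₂₂ b₁ b₂ : ℝ × ℝ → ℝ) (u : ℝ × ℝ → ℝ) (p : ℝ × ℝ) : ℝ :=
  a₁₁ p * pdx (pdx u) p - 2 * a₁₂ p * pdx (pdy u) p + a₂₂ p * pdy (pdy u) p +
    b₁ p * pdx u p + b₂ p * pdy u p

section PartialDerivatives

variable {f g : ℝ × ℝ → ℝ} {p : ℝ × ℝ}

theorem pdx_add (hf : DifferentiableAt ℝ f p) (hg : DifferentiableAt ℝ g p) :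
    pdx (fun q => f q + g q) p = pdx f p + pdx g p := by
  simp [pdx, fderiv_fun_add hf hg]

theorem pdy_add (hf : DifferentiableAt ℝ f p) (hg : DifferentiableAt ℝ g p) :
    pdy (fun q => f q + g q) p = pdy f p + pdy g p := by
  simp [pdy, fderiv_fun_add hf hg]

theorem pdx_mul (hf : DifferentiableAt ℝ f p) (hg : DifferentiableAt ℝ g p) :
    pdx (fun q => f q * g q) p = pdx f p * g p + f p * pdx g p := by
  simp [pdx, fderiv_fun_mul hf hg]
  ring

theorem pdy_mul (hf : DifferentiableAt ℝ f p) (hg : DifferentiableAt ℝ g p) :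
    pdy (fun q => f q * g q) p = pdy f p * g p + f p * pdy g p := by
  simp [pdy, fderiv_fun_mul hf hg]
  ring

theorem pdx_pow (hf : DifferentiableAt ℝ f p) (n : ℕ) :
    pdx (fun q => f q ^ n) p = n * f p ^ (n - 1) * pdx f p := by
  simp [pdx, fderiv_fun_pow n hf]

theorem pdy_pow (hf : DifferentiableAt ℝ f p) (n : ℕ) :
    pdy (fun q => f q ^ n) p = n * f p ^ (n - 1) * pdy f p := by
  simp [pdy, fderiv_fun_pow n hf]

theorem pdx_const (c : ℝ) : pdx (fun _ => c) p = 0 := by simp [pdx]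

theorem pdy_const (c : ℝ) : pdy (fun _ => c) p = 0 := by simp [pdy]

theorem pdx_fst : pdx (fun q => q.1) p = 1 := by simp [pdx, fderiv_fst]

theorem pdy_fst : pdy (fun q => q.1) p = 0 := by simp [pdy, fderiv_fst]

theorem pdx_snd : pdx (fun q => q.2) p = 0 := by simp [pdx, fderiv_snd]

theorem pdy_snd : pdy (fun q => q.2) p = 1 := by simp [pdy, fderiv_snd]

theorem pdx_congr (h : f =ᶠ[nhds p] g) : pdx f p = pdx g p := by
  simp [pdx, h.fderiv_eq]

theorem pdy_congr (h : f =ᶠ[nhds p] g) : pdy f p = pdy g p := by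
  simp [pdy, h.fderiv_eq]

theorem ContDiffAt.differentiableAt_pdx (hf : ContDiffAt ℝ 2 f p) :
    DifferentiableAt ℝ (pdx f) p :=
  ((hf.fderiv_right (m := 1) (by norm_num)).differentiableAt (by norm_num)).clm_apply
    (differentiableAt_const _)

theorem ContDiffAt.differentiableAt_pdy (hf : ContDiffAt ℝ 2 f p) :
    DifferentiableAt ℝ (pdy f) p :=
  ((hf.fderiv_right (m := 1) (by norm_num)).differentiableAt (by norm_num)).clm_apply
    (differentiableAt_const _)

theorem ContDiffAt.eventually_differentiableAt (hf : ContDiffAt ℝ 2 f p) :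
    ∀ᶠ q in nhds p, DifferentiableAt ℝ f q :=
  (hf.eventually (by simp)).mono fun _ h => h.differentiableAt (by norm_num)

end PartialDerivatives

/-- `f` is `C²` at `p`, with prescribed value and partial derivatives up to order two there. -/
structure HasTwoJetAt (f : ℝ × ℝ → ℝ) (p : ℝ × ℝ) (c cx cy cxx cxy cyy : ℝ) : Prop where
  contDiffAt : ContDiffAt ℝ 2 f p
  val : f p = c
  dx : pdx f p = cx
  dy : pdy f p = cy
  dxx : pdx (pdx f) p = cxx
  dxy : pdx (pdy f) p = cxy
  dyy : pdy (pdy f) p = cyy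

namespace HasTwoJetAt

variable {f g : ℝ × ℝ → ℝ} {p : ℝ × ℝ} {a ax ay axx axy ayy b bx bY bxx bxy byy : ℝ}

theorem of_contDiffAt (hf : ContDiffAt ℝ 2 f p) :
    HasTwoJetAt f p (f p) (pdx f p) (pdy f p)
      (pdx (pdx f) p) (pdx (pdy f) p) (pdy (pdy f) p) :=
  ⟨hf, rfl, rfl, rfl, rfl, rfl, rfl⟩

theorem add (hf : HasTwoJetAt f p a ax ay axx axy ayy)
    (hg : HasTwoJetAt g p b bx bY bxx bxy byy) :
    HasTwoJetAt (fun q => f q + g q) p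
      (a + b) (ax + bx) (ay + bY) (axx + bxx) (axy + bxy) (ayy + byy) := by
  have hF := hf.contDiffAt
  have hG := hg.contDiffAt
  have hx : pdx (fun q => f q + g q) =ᶠ[nhds p] fun q => pdx f q + pdx g q := by
    filter_upwards [hF.eventually_differentiableAt, hG.eventually_differentiableAt] with q h h'
    exact pdx_add h h'
  have hy : pdy (fun q => f q + g q) =ᶠ[nhds p] fun q => pdy f q + pdy g q := by
    filter_upwards [hF.eventually_differentiableAt, hG.eventually_differentiableAt] with q h h'
    exact pdy_add h h'
  refine ⟨hF.add hG, by rw [hf.val, hg.val], ?_, ?_, ?_, ?_, ?_⟩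
  · rw [hx.eq_of_nhds, hf.dx, hg.dx]
  · rw [hy.eq_of_nhds, hf.dy, hg.dy]
  · rw [pdx_congr hx, pdx_add hF.differentiableAt_pdx hG.differentiableAt_pdx, hf.dxx, hg.dxx]
  · rw [pdx_congr hy, pdx_add hF.differentiableAt_pdy hG.differentiableAt_pdy, hf.dxy, hg.dxy]
  · rw [pdy_congr hy, pdy_add hF.differentiableAt_pdy hG.differentiableAt_pdy, hf.dyy, hg.dyy]

theorem mul (hf : HasTwoJetAt f p a ax ay axx axy ayy)
    (hg : HasTwoJetAt g p b bx bY bxx bxy byy) :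
    HasTwoJetAt (fun q => f q * g q) p
      (a * b) (ax * b + a * bx) (ay * b + a * bY)
      (axx * b + 2 * (ax * bx) + a * bxx) (axy * b + ax * bY + ay * bx + a * bxy)
      (ayy * b + 2 * (ay * bY) + a * byy) := by
  have hF := hf.contDiffAt
  have hG := hg.contDiffAt
  have dF : DifferentiableAt ℝ f p := hF.differentiableAt (by norm_num)
  have dG : DifferentiableAt ℝ g p := hG.differentiableAt (by norm_num)
  have dFx := hF.differentiableAt_pdx
  have dFy := hF.differentiableAt_pdy
  have dGx := hG.differentiableAt_pdx
  have dGy := hG.differentiableAt_pdy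
  have hx : pdx (fun q => f q * g q) =ᶠ[nhds p] fun q => pdx f q * g q + f q * pdx g q := by
    filter_upwards [hF.eventually_differentiableAt, hG.eventually_differentiableAt] with q h h'
    exact pdx_mul h h'
  have hy : pdy (fun q => f q * g q) =ᶠ[nhds p] fun q => pdy f q * g q + f q * pdy g q := by
    filter_upwards [hF.eventually_differentiableAt, hG.eventually_differentiableAt] with q h h'
    exact pdy_mul h h'
  refine ⟨hF.mul hG, by rw [hf.val, hg.val], ?_, ?_, ?_, ?_, ?_⟩
  · rw [hx.eq_of_nhds, hf.dx, hg.dx, hf.val, hg.val]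
  · rw [hy.eq_of_nhds, hf.dy, hg.dy, hf.val, hg.val]
  · rw [pdx_congr hx, pdx_add (dFx.fun_mul dG) (dF.fun_mul dGx), pdx_mul dFx dG, pdx_mul dF dGx,
      hf.dxx, hg.dxx, hf.dx, hg.dx, hf.val, hg.val]
    ring
  · rw [pdx_congr hy, pdx_add (dFy.fun_mul dG) (dF.fun_mul dGy), pdx_mul dFy dG, pdx_mul dF dGy,
      hf.dxy, hg.dxy, hf.dx, hg.dx, hf.dy, hg.dy, hf.val, hg.val]
    ring
  · rw [pdy_congr hy, pdy_add (dFy.fun_mul dG) (dF.fun_mul dGy), pdy_mul dFy dG, pdy_mul dF dGy,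
      hf.dyy, hg.dyy, hf.dy, hg.dy, hf.val, hg.val]
    ring

theorem const (c : ℝ) : HasTwoJetAt (fun _ => c) p c 0 0 0 0 0 := by
  have hx : pdx (fun _ => c) = fun _ => 0 := funext fun _ => pdx_const c
  have hy : pdy (fun _ => c) = fun _ => 0 := funext fun _ => pdy_const c
  exact ⟨contDiffAt_const, rfl, pdx_const c, pdy_const c,
    by rw [hx, pdx_const], by rw [hy, pdx_const], by rw [hy, pdy_const]⟩

end HasTwoJetAt

/-- The quartic polynomial `x + y + c₁ x²/2 + c₂ x³/6 + c₃ x²y/2 + c₄ x⁴/24 + c₅ x³y/6 + c₆ x²y²/4`,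
with vanishing pure `y`-derivatives of order at least two. -/
noncomputable def quartic (c₁ c₂ c₃ c₄ c₅ c₆ : ℝ) (p : ℝ × ℝ) : ℝ :=
  p.1 + p.2 + c₁ / 2 * p.1 ^ 2 + c₂ / 6 * p.1 ^ 3 + c₃ / 2 * (p.1 ^ 2 * p.2) +
    c₄ / 24 * p.1 ^ 4 + c₅ / 6 * (p.1 ^ 3 * p.2) + c₆ / 4 * (p.1 ^ 2 * p.2 ^ 2)

section Quartic

variable (c₁ c₂ c₃ c₄ c₅ c₆ : ℝ)

theorem quartic_eq_eval :
    ∃ P : MvPolynomial (Fin 2) ℝ, P.totalDegree ≤ 4 ∧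
      ∀ p : ℝ × ℝ, quartic c₁ c₂ c₃ c₄ c₅ c₆ p = MvPolynomial.eval ![p.1, p.2] P := by
  open MvPolynomial in
  have hm (c : ℝ) (i j : ℕ) (h : i + j ≤ 4) :
      (C c * (X 0 ^ i * X 1 ^ j) : MvPolynomial (Fin 2) ℝ).totalDegree ≤ 4 := by
    refine (totalDegree_mul _ _).trans ?_
    rw [totalDegree_C, zero_add]
    refine (totalDegree_mul _ _).trans ?_
    simpa only [totalDegree_X_pow] using h
  have ha {P Q : MvPolynomial (Fin 2) ℝ} (hP : P.totalDegree ≤ 4) (hQ : Q.totalDegree ≤ 4) :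
      (P + Q).totalDegree ≤ 4 :=
    (MvPolynomial.totalDegree_add _ _).trans (max_le hP hQ)
  refine ⟨_, ha (ha (ha (ha (ha (ha (ha (hm 1 1 0 ?_) (hm 1 0 1 ?_)) (hm (c₁ / 2) 2 0 ?_))
    (hm (c₂ / 6) 3 0 ?_)) (hm (c₃ / 2) 2 1 ?_)) (hm (c₄ / 24) 4 0 ?_)) (hm (c₅ / 6) 3 1 ?_))
    (hm (c₆ / 4) 2 2 ?_), fun p => ?_⟩
  any_goals norm_num
  simp [quartic]

theorem pdx_quartic : pdx (quartic c₁ c₂ c₃ c₄ c₅ c₆) = fun p =>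
    1 + c₁ * p.1 + c₂ / 2 * p.1 ^ 2 + c₃ * (p.1 * p.2) + c₄ / 6 * p.1 ^ 3 +
      c₅ / 2 * (p.1 ^ 2 * p.2) + c₆ / 2 * (p.1 * p.2 ^ 2) := by
  funext p
  unfold quartic
  simp (disch := fun_prop) only [pdx_add, pdx_mul, pdx_pow, pdx_const, pdx_fst, pdx_snd]
  norm_num
  ring

theorem pdy_quartic : pdy (quartic c₁ c₂ c₃ c₄ c₅ c₆) = fun p =>
    1 + c₃ / 2 * p.1 ^ 2 + c₅ / 6 * p.1 ^ 3 + c₆ / 2 * (p.1 ^ 2 * p.2) := by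
  funext p
  unfold quartic
  simp (disch := fun_prop) only [pdy_add, pdy_mul, pdy_pow, pdy_const, pdy_fst, pdy_snd]
  norm_num
  ring

theorem pdx_pdx_quartic : pdx (pdx (quartic c₁ c₂ c₃ c₄ c₅ c₆)) = fun p =>
    c₁ + c₂ * p.1 + c₃ * p.2 + c₄ / 2 * p.1 ^ 2 + c₅ * (p.1 * p.2) + c₆ / 2 * p.2 ^ 2 := by
  rw [pdx_quartic]
  funext p
  simp (disch := fun_prop) only [pdx_add, pdx_mul, pdx_pow, pdx_const, pdx_fst, pdx_snd]
  norm_num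
  ring

theorem pdx_pdy_quartic : pdx (pdy (quartic c₁ c₂ c₃ c₄ c₅ c₆)) = fun p =>
    c₃ * p.1 + c₅ / 2 * p.1 ^ 2 + c₆ * (p.1 * p.2) := by
  rw [pdy_quartic]
  funext p
  simp (disch := fun_prop) only [pdx_add, pdx_mul, pdx_pow, pdx_const, pdx_fst, pdx_snd]
  norm_num
  ring

theorem pdy_pdy_quartic : pdy (pdy (quartic c₁ c₂ c₃ c₄ c₅ c₆)) = fun p =>
    c₆ / 2 * p.1 ^ 2 := by
  rw [pdy_quartic]
  funext p
  simp (disch := fun_prop) only [pdy_add, pdy_mul, pdy_pow, pdy_const, pdy_fst, pdy_snd]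
  norm_num

theorem hasTwoJetAt_pdx_quartic :
    HasTwoJetAt (pdx (quartic c₁ c₂ c₃ c₄ c₅ c₆)) (0, 0) 1 c₁ 0 c₂ c₃ 0 := by
  have hy : pdy (pdx (quartic c₁ c₂ c₃ c₄ c₅ c₆)) = fun p =>
      c₃ * p.1 + c₅ / 2 * p.1 ^ 2 + c₆ * (p.1 * p.2) := by
    rw [pdx_quartic]
    funext p
    simp (disch := fun_prop) only [pdy_add, pdy_mul, pdy_pow, pdy_const, pdy_fst, pdy_snd]
    norm_num
    ring
  constructor
  · rw [pdx_quartic]; fun_prop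
  · simp [pdx_quartic]
  · simp [pdx_pdx_quartic]
  · simp [hy]
  all_goals
    simp (disch := fun_prop) [pdx_pdx_quartic, hy, pdx_add, pdx_mul, pdx_pow, pdx_const,
      pdx_fst, pdx_snd, pdy_add, pdy_mul, pdy_pow, pdy_const, pdy_fst, pdy_snd]

theorem hasTwoJetAt_pdy_quartic :
    HasTwoJetAt (pdy (quartic c₁ c₂ c₃ c₄ c₅ c₆)) (0, 0) 1 0 0 c₃ 0 0 := by
  constructor
  · rw [pdy_quartic]; fun_prop
  · simp [pdy_quartic]
  · simp [pdx_pdy_quartic]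
  · simp [pdy_pdy_quartic]
  all_goals
    simp (disch := fun_prop) [pdx_pdy_quartic, pdy_pdy_quartic, pdx_add, pdx_mul, pdx_pow,
      pdx_const, pdx_fst, pdx_snd, pdy_mul, pdy_pow, pdy_const, pdy_fst]

/-- The two-jet at the origin of a quadratic polynomial. -/
theorem hasTwoJetAt_quadratic (c cx cy cxx cxy cyy : ℝ) :
    HasTwoJetAt (fun p => c + cx * p.1 + cy * p.2 + cxx / 2 * p.1 ^ 2 + cxy * (p.1 * p.2) +
      cyy / 2 * p.2 ^ 2) (0, 0) c cx cy cxx cxy cyy := by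
  have hx : pdx (fun p => c + cx * p.1 + cy * p.2 + cxx / 2 * p.1 ^ 2 + cxy * (p.1 * p.2) +
      cyy / 2 * p.2 ^ 2) = fun p => cx + cxx * p.1 + cxy * p.2 := by
    funext p
    simp (disch := fun_prop) only [pdx_add, pdx_mul, pdx_pow, pdx_const, pdx_fst, pdx_snd]
    norm_num
    ring
  have hy : pdy (fun p => c + cx * p.1 + cy * p.2 + cxx / 2 * p.1 ^ 2 + cxy * (p.1 * p.2) +
      cyy / 2 * p.2 ^ 2) = fun p => cy + cxy * p.1 + cyy * p.2 := by
    funext p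
    simp (disch := fun_prop) only [pdy_add, pdy_mul, pdy_pow, pdy_const, pdy_fst, pdy_snd]
    norm_num
    ring
  constructor
  · fun_prop
  · simp
  · simp [hx]
  · simp [hy]
  all_goals
    simp (disch := fun_prop) [hx, hy, pdx_add, pdx_mul, pdx_const,
      pdx_fst, pdx_snd, pdy_add, pdy_mul, pdy_const, pdy_fst, pdy_snd]

theorem hasTwoJetAt_pdx_pdx_quartic :
    HasTwoJetAt (pdx (pdx (quartic c₁ c₂ c₃ c₄ c₅ c₆))) (0, 0) c₁ c₂ c₃ c₄ c₅ c₆ := by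
  rw [pdx_pdx_quartic]
  exact hasTwoJetAt_quadratic ..

theorem hasTwoJetAt_pdx_pdy_quartic :
    HasTwoJetAt (pdx (pdy (quartic c₁ c₂ c₃ c₄ c₅ c₆))) (0, 0) 0 c₃ 0 c₅ c₆ 0 := by
  rw [pdx_pdy_quartic]
  simpa using hasTwoJetAt_quadratic 0 c₃ 0 c₅ c₆ 0

theorem hasTwoJetAt_pdy_pdy_quartic :
    HasTwoJetAt (pdy (pdy (quartic c₁ c₂ c₃ c₄ c₅ c₆))) (0, 0) 0 0 0 c₆ 0 0 := by
  rw [pdy_pdy_quartic]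
  simpa using hasTwoJetAt_quadratic 0 0 0 c₆ 0 0

end Quartic

/-- Construction of the approximate solution: a polynomial `ζ` of degree at most `4` with
`ζ_x(0) = ζ_y(0) = 1`, such that `Lζ` vanishes at `0` together with all of its first- and
second-order partial derivatives. -/
theorem exists_approximate_solution (V : Set (ℝ × ℝ)) (hV : IsOpen V) (h0 : (0, 0) ∈ V)
    (a₁₁ a₁₂ a₂₂ b₁ b₂ : ℝ × ℝ → ℝ)
    (ha₁₁ : ContDiffOn ℝ 2 a₁₁ V) (ha₁₂ : ContDiffOn ℝ 2 a₁₂ V) (ha₂₂ : ContDiffOn ℝ 2 a₂₂ V)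
    (hb₁ : ContDiffOn ℝ 2 b₁ V) (hb₂ : ContDiffOn ℝ 2 b₂ V)
    (ha₁₁0 : a₁₁ (0, 0) = 1) (ha₂₂0 : a₂₂ (0, 0) = 1) (ha₁₂0 : a₁₂ (0, 0) = 0) :
    ∃ ζ : ℝ × ℝ → ℝ,
      (∃ P : MvPolynomial (Fin 2) ℝ, P.totalDegree ≤ 4 ∧
        ∀ p : ℝ × ℝ, ζ p = MvPolynomial.eval ![p.1, p.2] P) ∧
      pdx ζ (0, 0) = 1 ∧ pdy ζ (0, 0) = 1 ∧
      ellOp a₁₁ a₁₂ a₂₂ b₁ b₂ ζ (0, 0) = 0 ∧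
      pdx (ellOp a₁₁ a₁₂ a₂₂ b₁ b₂ ζ) (0, 0) = 0 ∧
      pdy (ellOp a₁₁ a₁₂ a₂₂ b₁ b₂ ζ) (0, 0) = 0 ∧
      pdx (pdx (ellOp a₁₁ a₁₂ a₂₂ b₁ b₂ ζ)) (0, 0) = 0 ∧
      pdx (pdy (ellOp a₁₁ a₁₂ a₂₂ b₁ b₂ ζ)) (0, 0) = 0 ∧
      pdy (pdy (ellOp a₁₁ a₁₂ a₂₂ b₁ b₂ ζ)) (0, 0) = 0 := by
  have hV0 := hV.mem_nhds h0
  have jA := HasTwoJetAt.of_contDiffAt (ha₁₁.contDiffAt hV0)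
  have jB := HasTwoJetAt.of_contDiffAt (ha₁₂.contDiffAt hV0)
  have jC := HasTwoJetAt.of_contDiffAt (ha₂₂.contDiffAt hV0)
  have jD := HasTwoJetAt.of_contDiffAt (hb₁.contDiffAt hV0)
  have jE := HasTwoJetAt.of_contDiffAt (hb₂.contDiffAt hV0)
  rw [ha₁₁0] at jA
  rw [ha₁₂0] at jB
  rw [ha₂₂0] at jC
  generalize pdx a₁₁ (0, 0) = Ax, pdy a₁₁ (0, 0) = Ay, pdx (pdx a₁₁) (0, 0) = Axx,
    pdx (pdy a₁₁) (0, 0) = Axy, pdy (pdy a₁₁) (0, 0) = Ayy at jA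
  generalize pdx a₁₂ (0, 0) = Bx, pdy a₁₂ (0, 0) = By, pdx (pdx a₁₂) (0, 0) = Bxx,
    pdx (pdy a₁₂) (0, 0) = Bxy, pdy (pdy a₁₂) (0, 0) = Byy at jB
  generalize b₁ (0, 0) = D, pdx b₁ (0, 0) = Dx, pdy b₁ (0, 0) = Dy, pdx (pdx b₁) (0, 0) = Dxx,
    pdx (pdy b₁) (0, 0) = Dxy, pdy (pdy b₁) (0, 0) = Dyy at jD
  generalize b₂ (0, 0) = E, pdx b₂ (0, 0) = Ex, pdy b₂ (0, 0) = Ey, pdx (pdx b₂) (0, 0) = Exx,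
    pdx (pdy b₂) (0, 0) = Exy, pdy (pdy b₂) (0, 0) = Eyy at jE
  obtain ⟨c₁, h₁⟩ : ∃ c, c = -(D + E) := ⟨_, rfl⟩
  obtain ⟨c₂, h₂⟩ : ∃ c, c = -(Ax * c₁ + Dx + D * c₁ + Ex) := ⟨_, rfl⟩
  obtain ⟨c₃, h₃⟩ : ∃ c, c = -(Ay * c₁ + Dy + Ey) := ⟨_, rfl⟩
  obtain ⟨c₆, h₆⟩ : ∃ c, c = -(Ayy * c₁ + 2 * Ay * c₃ + Dyy + Eyy) := ⟨_, rfl⟩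
  obtain ⟨c₅, h₅⟩ : ∃ c, c = -(Axy * c₁ + Ax * c₃ + Ay * c₂ - 2 * By * c₃ + Dxy + Dy * c₁ +
    D * c₃ + Exy) := ⟨_, rfl⟩
  obtain ⟨c₄, h₄⟩ : ∃ c, c = -(Axx * c₁ + 2 * Ax * c₂ - 4 * Bx * c₃ + c₆ + Dxx + 2 * Dx * c₁ +
    D * c₂ + Exx + E * c₃) := ⟨_, rfl⟩
  have hL : ellOp a₁₁ a₁₂ a₂₂ b₁ b₂ (quartic c₁ c₂ c₃ c₄ c₅ c₆) = fun p =>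
      a₁₁ p * pdx (pdx (quartic c₁ c₂ c₃ c₄ c₅ c₆)) p +
        (-2) * (a₁₂ p * pdx (pdy (quartic c₁ c₂ c₃ c₄ c₅ c₆)) p) +
        a₂₂ p * pdy (pdy (quartic c₁ c₂ c₃ c₄ c₅ c₆)) p +
        b₁ p * pdx (quartic c₁ c₂ c₃ c₄ c₅ c₆) p + b₂ p * pdy (quartic c₁ c₂ c₃ c₄ c₅ c₆) p := by
    funext p
    unfold ellOp
    ring
  have jx := hasTwoJetAt_pdx_quartic c₁ c₂ c₃ c₄ c₅ c₆
  have jy := hasTwoJetAt_pdy_quartic c₁ c₂ c₃ c₄ c₅ c₆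
  have jL := ((((jA.mul (hasTwoJetAt_pdx_pdx_quartic c₁ c₂ c₃ c₄ c₅ c₆)).add
    ((HasTwoJetAt.const (-2)).mul (jB.mul (hasTwoJetAt_pdx_pdy_quartic c₁ c₂ c₃ c₄ c₅ c₆)))).add
    (jC.mul (hasTwoJetAt_pdy_pdy_quartic c₁ c₂ c₃ c₄ c₅ c₆))).add (jD.mul jx)).add (jE.mul jy)
  rw [← hL] at jL
  refine ⟨quartic c₁ c₂ c₃ c₄ c₅ c₆, quartic_eq_eval .., jx.val, jy.val, jL.val.trans ?_,
    jL.dx.trans ?_, jL.dy.trans ?_, jL.dxx.trans ?_, jL.dxy.trans ?_, jL.dyy.trans ?_⟩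
  · linear_combination h₁
  · linear_combination h₂
  · linear_combination h₃
  · linear_combination h₄
  · linear_combination h₅
  · linear_combination h₆
end
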